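/- Let n ≥ 1 and 1 < p < ∞, and let w be a weight on ℝⁿ. Then there exists a constant C > 0 such that ‖w^{1/p}·Mf‖_{L^{p,∞}} ≤ C·‖f‖_{L^p(w)} for every f ∈ L^p(w) if and only if w ∈ A_p^*. -/

import Mathlib

open MeasureTheory Set
open scoped ENNReal

noncomputable section

/-- An axis-parallel cube in `ℝⁿ` (realized as `Fin n → ℝ`) with positive finite side length. -/
def IsCube (n : ℕ) (Q : Set (Fin n → ℝ)) : Prop :=
  ∃ (a : Fin n → ℝ) (h : ℝ), 0 < h ∧ Q = Set.univ.pi fun i => Set.Icc (a i) (a i + h)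

/-- The weak `L^p` quasinorm `sup_{t>0} t · |{x : g x > t}|^{1/p}` of an `ℝ≥0∞`-valued
function on `ℝⁿ`. -/
def wnormE (n : ℕ) (p : ℝ) (g : (Fin n → ℝ) → ℝ≥0∞) : ℝ≥0∞ :=
  ⨆ (t : ℝ) (_ : 0 < t), ENNReal.ofReal t * volume {x | ENNReal.ofReal t < g x} ^ (1 / p)

/-- The Hardy–Littlewood maximal operator: supremum of averages of `|f|` over cubes
containing `x`. -/
def maximalFn (n : ℕ) (f : (Fin n → ℝ) → ℝ) (x : Fin n → ℝ) : ℝ≥0∞ :=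
  ⨆ (Q : Set (Fin n → ℝ)) (_ : IsCube n Q) (_ : x ∈ Q),
    (volume Q)⁻¹ * ∫⁻ y in Q, ENNReal.ofReal |f y|

/-- The fractional maximal operator `M_α`. -/
def fracMaximalFn (n : ℕ) (α : ℝ) (f : (Fin n → ℝ) → ℝ) (x : Fin n → ℝ) : ℝ≥0∞ :=
  ⨆ (Q : Set (Fin n → ℝ)) (_ : IsCube n Q) (_ : x ∈ Q),
    volume Q ^ (α / (n : ℝ)) * ((volume Q)⁻¹ * ∫⁻ y in Q, ENNReal.ofReal |f y|)

/-- The multiplier `A_p^*` characteristic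
`[w]_{A_p^*} = sup_Q (|Q|⁻¹·‖w·χ_Q‖_{L^{1,∞}})·(⨍_Q w^{1-p'})^{p-1}`, with `p' = p/(p-1)`. -/
def ApStarConst (n : ℕ) (p : ℝ) (w : (Fin n → ℝ) → ℝ) : ℝ≥0∞ :=
  ⨆ (Q : Set (Fin n → ℝ)) (_ : IsCube n Q),
    (volume Q)⁻¹ * wnormE n 1 (Q.indicator fun x => ENNReal.ofReal (w x)) *
      ((volume Q)⁻¹ * ∫⁻ x in Q, ENNReal.ofReal (w x ^ (1 - p / (p - 1)))) ^ (p - 1)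

/-- The multiplier `A_{p,q}^*` characteristic
`[w]_{A_{p,q}^*} = sup_Q (|Q|⁻¹·‖w^q·χ_Q‖_{L^{1,∞}})^{1/q}·(⨍_Q w^{-p'})^{1/p'}`,
with `p' = p/(p-1)` and `1/p' = 1 - 1/p`. -/
def ApqStarConst (n : ℕ) (p q : ℝ) (w : (Fin n → ℝ) → ℝ) : ℝ≥0∞ :=
  ⨆ (Q : Set (Fin n → ℝ)) (_ : IsCube n Q),
    ((volume Q)⁻¹ * wnormE n 1 (Q.indicator fun x => ENNReal.ofReal (w x ^ q))) ^ (1 / q) *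
      ((volume Q)⁻¹ * ∫⁻ x in Q, ENNReal.ofReal (w x ^ (-(p / (p - 1))))) ^ (1 - 1 / p)

/-- The Muckenhoupt `A_p` characteristic `[w]_{A_p} = sup_Q (⨍_Q w)·(⨍_Q w^{1-p'})^{p-1}`. -/
def ApConst (n : ℕ) (p : ℝ) (w : (Fin n → ℝ) → ℝ) : ℝ≥0∞ :=
  ⨆ (Q : Set (Fin n → ℝ)) (_ : IsCube n Q),
    ((volume Q)⁻¹ * ∫⁻ x in Q, ENNReal.ofReal (w x)) *
      ((volume Q)⁻¹ * ∫⁻ x in Q, ENNReal.ofReal (w x ^ (1 - p / (p - 1)))) ^ (p - 1)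

/-- The Muckenhoupt `A_{p,q}` characteristic
`[w]_{A_{p,q}} = sup_Q (⨍_Q w^q)^{1/q}·(⨍_Q w^{-p'})^{1/p'}`. -/
def ApqConst (n : ℕ) (p q : ℝ) (w : (Fin n → ℝ) → ℝ) : ℝ≥0∞ :=
  ⨆ (Q : Set (Fin n → ℝ)) (_ : IsCube n Q),
    ((volume Q)⁻¹ * ∫⁻ x in Q, ENNReal.ofReal (w x ^ q)) ^ (1 / q) *
      ((volume Q)⁻¹ * ∫⁻ x in Q, ENNReal.ofReal (w x ^ (-(p / (p - 1))))) ^ (1 - 1 / p)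


lemma geom_upper (q : ℝ) (hq : 0 < q) : ∃ C : ℝ≥0∞, C ≠ ∞ ∧ ∀ y : ℝ≥0∞,
    ∑' k : ℤ, (if (2 : ℝ≥0∞) ^ k < y then ((2 : ℝ≥0∞) ^ k) ^ q else 0) ≤ C * y ^ q := by
  have hlt : ((2 : ℝ≥0∞) ^ (-q)) < 1 := by
    apply ENNReal.rpow_lt_one_of_one_lt_of_neg <;> simp [hq]
  refine ⟨(1 - (2 : ℝ≥0∞) ^ (-q))⁻¹, ?_, ?_⟩
  · rw [ENNReal.inv_ne_top]
    exact (tsub_pos_of_lt hlt).ne'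
  intro y
  rcases eq_or_ne y ∞ with rfl | hyt
  · rw [ENNReal.top_rpow_of_pos hq, ENNReal.mul_top]
    · exact le_top
    · rw [ENNReal.inv_ne_zero]
      exact (tsub_le_self.trans_lt ENNReal.one_lt_top).ne
  rcases eq_or_ne y 0 with rfl | hy0
  · simp
  obtain ⟨m, hm1, hm2⟩ := ENNReal.exists_mem_Ioc_zpow hy0 hyt (y := 2) (by norm_num) (by norm_num)
  set t : ℤ → ℝ≥0∞ := fun k => if (2 : ℝ≥0∞) ^ k < y then ((2 : ℝ≥0∞) ^ k) ^ q else 0 with ht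
  have h1 : ∑' k : ℤ, t k = ∑' j : ℕ, t (m - j) := by
    rw [← (Equiv.subLeft m).tsum_eq t]
    symm
    have := Function.Injective.tsum_eq (f := fun j : ℤ => t (m - j)) (Nat.cast_injective (R := ℤ)) ?_
    · simpa using this
    · intro j hj
      simp only [ht, Function.mem_support, ne_eq, ite_eq_right_iff, not_forall] at hj
      obtain ⟨hj, -⟩ := hj
      have h2 := hj.trans_le hm2
      have h3 : m - j < m + 1 := by
        by_contra h
        push Not at h
        exact absurd (ENNReal.zpow_le_of_le (x := 2) (by norm_num) h) (not_le.2 h2)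
      exact ⟨j.toNat, by omega⟩
  rw [h1]
  have h2 : ∀ j : ℕ, t (m - j) ≤ ((2 : ℝ≥0∞) ^ m) ^ q * ((2 : ℝ≥0∞) ^ (-q)) ^ j := by
    intro j
    have : ((2 : ℝ≥0∞) ^ (m - (j:ℤ))) ^ q = ((2 : ℝ≥0∞) ^ m) ^ q * ((2 : ℝ≥0∞) ^ (-q)) ^ j := by
      rw [← ENNReal.rpow_intCast, ← ENNReal.rpow_intCast, ← ENNReal.rpow_natCast, ← ENNReal.rpow_mul,
        ← ENNReal.rpow_mul, ← ENNReal.rpow_mul, ← ENNReal.rpow_add _ _ (by norm_num) (by norm_num)]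
      congr 1
      push_cast
      ring
    rw [← this]
    simp only [ht]
    split_ifs <;> simp
  calc ∑' j : ℕ, t (m - j) ≤ ∑' j : ℕ, ((2 : ℝ≥0∞) ^ m) ^ q * ((2 : ℝ≥0∞) ^ (-q)) ^ j :=
        ENNReal.tsum_le_tsum h2
    _ = ((2 : ℝ≥0∞) ^ m) ^ q * (1 - (2 : ℝ≥0∞) ^ (-q))⁻¹ := by
        rw [ENNReal.tsum_mul_left, ENNReal.tsum_geometric]
    _ ≤ _ := by
        rw [mul_comm]
        gcongr

lemma geom_lower (q : ℝ) (hq : 0 < q) (y : ℝ≥0∞) :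
    y ^ q ≤ 2 ^ q * ∑' k : ℤ, (if (2 : ℝ≥0∞) ^ k < y then ((2 : ℝ≥0∞) ^ k) ^ q else 0) := by
  rcases eq_or_ne y ∞ with rfl | hyt
  · rw [ENNReal.top_rpow_of_pos hq]
    have : ∑' k : ℤ, (if (2 : ℝ≥0∞) ^ k < ∞ then ((2 : ℝ≥0∞) ^ k) ^ q else 0) = ∞ := by
      rw [← top_le_iff]
      calc (∞ : ℝ≥0∞) = ∑' k : ℕ, (1 : ℝ≥0∞) := by simp
        _ ≤ ∑' k : ℕ, (if (2 : ℝ≥0∞) ^ (k:ℤ) < ∞ then ((2 : ℝ≥0∞) ^ (k:ℤ)) ^ q else 0) := by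
          apply ENNReal.tsum_le_tsum
          intro k
          have : (2 : ℝ≥0∞) ^ (k:ℤ) < ∞ := by
            simp
          rw [if_pos this]
          apply ENNReal.one_le_rpow _ hq
          rw [zpow_natCast]
          exact one_le_pow₀ (by norm_num)
        _ ≤ _ := ENNReal.tsum_comp_le_tsum_of_injective (Nat.cast_injective (R := ℤ))
              (fun k : ℤ => (if (2 : ℝ≥0∞) ^ k < ∞ then ((2 : ℝ≥0∞) ^ k) ^ q else 0))
    rw [this, ENNReal.mul_top (by simp)]
  rcases eq_or_ne y 0 with rfl | hy0
  · simp [hq]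
  obtain ⟨m, hm1, hm2⟩ := ENNReal.exists_mem_Ioc_zpow hy0 hyt (y := 2) (by norm_num) (by norm_num)
  calc y ^ q ≤ ((2 : ℝ≥0∞) ^ (m+1)) ^ q := by gcongr
    _ = 2 ^ q * ((2 : ℝ≥0∞) ^ m) ^ q := by
      rw [ENNReal.zpow_add (by norm_num) (by norm_num), ENNReal.mul_rpow_of_nonneg _ _ hq.le, mul_comm]
      simp
    _ ≤ _ := by
      gcongr
      refine le_trans ?_ (ENNReal.le_tsum m)
      rw [if_pos hm1]

lemma vit_cover {n : ℕ} (T : Set ((Fin n → ℝ) × ℝ)) (R : ℝ)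
    (hT : ∀ b ∈ T, 0 < b.2 ∧ b.2 ≤ R) :
    ∃ u ⊆ T, u.Countable ∧ (u.PairwiseDisjoint fun b => Metric.closedBall b.1 b.2) ∧
      ∀ b ∈ T, Metric.closedBall b.1 b.2 ⊆ ⋃ c ∈ u, Metric.closedBall c.1 (5 * c.2) := by
  obtain ⟨u, huT, hd, hc⟩ := Vitali.exists_disjoint_subfamily_covering_enlargement_closedBall
    T (fun b => b.1) (fun b => b.2) R (fun b hb => (hT b hb).2) 5 (by norm_num)
  refine ⟨u, huT, ?_, hd, ?_⟩
  · refine hd.countable_of_nonempty_interior fun b hb => ?_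
    exact (Metric.nonempty_ball.2 (hT b (huT hb)).1).mono Metric.ball_subset_interior_closedBall
  · intro b hb
    obtain ⟨c, hcu, hbc⟩ := hc b hb
    exact hbc.trans (subset_biUnion_of_mem (u := fun c : (Fin n → ℝ) × ℝ =>
      Metric.closedBall c.1 (5 * c.2)) hcu)

lemma weak_max {n : ℕ} (μ : Measure (Fin n → ℝ)) (D : ℝ≥0∞)
    (hD : ∀ c r, 0 < r → μ (Metric.closedBall c (5 * r)) ≤ D * μ (Metric.closedBall c r))
    (hfin : ∀ c r, 0 < r → μ (Metric.closedBall c r) ≠ ∞)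
    (G : (Fin n → ℝ) → ℝ≥0∞) (hG : Measurable G) (l : ℝ≥0∞) (hlt : l ≠ ∞)
    (T : Set ((Fin n → ℝ) × ℝ)) (R : ℝ) (hT : ∀ b ∈ T, 0 < b.2 ∧ b.2 ≤ R)
    (hT2 : ∀ b ∈ T, 2 * l * μ (Metric.closedBall b.1 b.2) ≤ ∫⁻ x in Metric.closedBall b.1 b.2, G x ∂μ) :
    l * μ (⋃ b ∈ T, Metric.closedBall b.1 b.2) ≤ D * ∫⁻ x, (if l < G x then G x else 0) ∂μ := by
  obtain ⟨u, huT, huc, hd, hc⟩ := vit_cover T R hT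
  have key : ∀ b ∈ T, l * μ (Metric.closedBall b.1 b.2) ≤
      ∫⁻ x in Metric.closedBall b.1 b.2, (if l < G x then G x else 0) ∂μ := by
    intro b hb
    have h1 := hT2 b hb
    have hf := hfin b.1 b.2 (hT b hb).1
    have hm : Measurable fun x => (if l < G x then G x else 0) :=
      Measurable.ite (measurableSet_lt measurable_const hG) hG measurable_const
    have h2 : ∫⁻ x in Metric.closedBall b.1 b.2, G x ∂μ ≤
        ∫⁻ x in Metric.closedBall b.1 b.2, (if l < G x then G x else 0) ∂μ +
          l * μ (Metric.closedBall b.1 b.2) := by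
      rw [← setLIntegral_const, ← lintegral_add_left hm]
      apply lintegral_mono
      intro x
      dsimp only
      split_ifs with h
      · exact le_self_add
      · rw [zero_add]; exact not_lt.1 h
    have h3 := h1.trans h2
    rw [mul_assoc, two_mul] at h3
    exact (ENNReal.add_le_add_iff_right (ENNReal.mul_ne_top hlt hf)).1 h3
  have := huc.to_subtype
  calc l * μ (⋃ b ∈ T, Metric.closedBall b.1 b.2)
      ≤ l * μ (⋃ c ∈ u, Metric.closedBall c.1 (5 * c.2)) := by
        exact mul_le_mul' le_rfl (measure_mono (iUnion₂_subset hc))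
    _ ≤ l * ∑' c : u, μ (Metric.closedBall c.1.1 (5 * c.1.2)) := by
        gcongr
        exact measure_biUnion_le _ huc _
    _ ≤ l * ∑' c : u, D * μ (Metric.closedBall c.1.1 c.1.2) := by
        gcongr with c
        exact hD _ _ (hT _ (huT c.2)).1
    _ = D * ∑' c : u, l * μ (Metric.closedBall c.1.1 c.1.2) := by
        rw [ENNReal.tsum_mul_left, ENNReal.tsum_mul_left]; ring
    _ ≤ D * ∑' c : u, ∫⁻ x in Metric.closedBall c.1.1 c.1.2, (if l < G x then G x else 0) ∂μ := by
        gcongr with c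
        exact key _ (huT c.2)
    _ = D * ∫⁻ x in ⋃ c ∈ u, Metric.closedBall c.1 c.2, (if l < G x then G x else 0) ∂μ := by
        rw [lintegral_biUnion huc (fun _ _ => Metric.isClosed_closedBall.measurableSet) hd]
    _ ≤ _ := by
        exact mul_le_mul' le_rfl (setLIntegral_le_lintegral _ _)

/-- The maximal function along a family of balls. -/
def famMax {n : ℕ} (μ : Measure (Fin n → ℝ)) (S : Set ((Fin n → ℝ) × ℝ))
    (G : (Fin n → ℝ) → ℝ≥0∞) (x : Fin n → ℝ) : ℝ≥0∞ :=
  ⨆ b ∈ S, (Metric.closedBall b.1 b.2).indicator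
    (fun _ => (μ (Metric.closedBall b.1 b.2))⁻¹ * ∫⁻ y in Metric.closedBall b.1 b.2, G y ∂μ) x

lemma famMax_meas {n : ℕ} (μ : Measure (Fin n → ℝ)) (S : Set ((Fin n → ℝ) × ℝ)) (hS : S.Countable)
    (G : (Fin n → ℝ) → ℝ≥0∞) : Measurable (famMax μ S G) := by
  unfold famMax
  refine Measurable.biSup S hS fun b _ => ?_
  exact measurable_const.indicator Metric.isClosed_closedBall.measurableSet

lemma strong_max (n : ℕ) (p : ℝ) (hp : 1 < p) (D : ℝ≥0∞) (hDt : D ≠ ∞) :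
    ∃ C : ℝ≥0∞, C ≠ ∞ ∧ ∀ (μ : Measure (Fin n → ℝ))
    (_ : ∀ c r, 0 < r → μ (Metric.closedBall c (5 * r)) ≤ D * μ (Metric.closedBall c r))
    (_ : ∀ c r, 0 < r → μ (Metric.closedBall c r) ≠ ∞)
    (_ : ∀ c r, 0 < r → μ (Metric.closedBall c r) ≠ 0)
    (G : (Fin n → ℝ) → ℝ≥0∞) (_ : Measurable G)
    (S : Set ((Fin n → ℝ) × ℝ)) (_ : S.Countable) (R : ℝ) (_ : ∀ b ∈ S, 0 < b.2 ∧ b.2 ≤ R),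
    ∫⁻ x, famMax μ S G x ^ p ∂μ ≤ C * ∫⁻ x, G x ^ p ∂μ := by
  obtain ⟨C, hC, hgeo⟩ := geom_upper (p - 1) (by linarith)
  have hp0 : 0 < p := by linarith
  refine ⟨2 ^ p * 2 ^ p * D * C, ?_, ?_⟩
  · have : (2 : ℝ≥0∞) ^ p ≠ ∞ := by simp
    exact ENNReal.mul_ne_top (ENNReal.mul_ne_top (ENNReal.mul_ne_top this this) hDt) hC
  intro μ hD hfin hpos G hG S hS R hSR
  have hM := famMax_meas μ S hS G
  have h2t : ∀ k : ℤ, (2 : ℝ≥0∞) ^ k ≠ ∞ := fun k => ENNReal.zpow_ne_top (by norm_num) (by norm_num) k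
  have h20 : ∀ k : ℤ, (2 : ℝ≥0∞) ^ k ≠ 0 := fun k => (ENNReal.zpow_pos (by norm_num) (by norm_num) k).ne'
  have hlev : ∀ k : ℤ, 2 ^ k * μ {x | 2 * 2 ^ k < famMax μ S G x} ≤
      D * ∫⁻ x, (if 2 ^ k < G x then G x else 0) ∂μ := by
    intro k
    refine le_trans ?_ (weak_max μ D hD hfin G hG (2 ^ k) (h2t k)
      {b ∈ S | 2 * 2 ^ k < (μ (Metric.closedBall b.1 b.2))⁻¹ *
        ∫⁻ y in Metric.closedBall b.1 b.2, G y ∂μ} R (fun b hb => hSR b hb.1) ?_)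
    · gcongr
      intro x hx
      simp only [mem_ofPred_eq, famMax, lt_iSup_iff] at hx
      obtain ⟨b, hb, hx⟩ := hx
      by_cases hxb : x ∈ Metric.closedBall b.1 b.2
      · rw [indicator_of_mem hxb] at hx
        exact mem_biUnion (x := b) ⟨hb, hx⟩ hxb
      · rw [indicator_of_notMem hxb] at hx
        exact absurd hx (by simp)
    · rintro b ⟨hb, hlt⟩
      have h0 := hpos b.1 b.2 (hSR b hb).1
      have ht := hfin b.1 b.2 (hSR b hb).1
      rw [mul_comm _ (∫⁻ y in _, G y ∂μ), ← div_eq_mul_inv,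
        ENNReal.lt_div_iff_mul_lt (Or.inl h0) (Or.inl ht)] at hlt
      exact hlt.le
  have hms : ∀ k : ℤ, MeasurableSet {x | 2 * 2 ^ k < famMax μ S G x} :=
    fun k => measurableSet_lt measurable_const hM
  calc ∫⁻ x, famMax μ S G x ^ p ∂μ
      ≤ ∫⁻ x, 2 ^ p * 2 ^ p * ∑' k : ℤ, (2 ^ k) ^ p *
          {x | 2 * 2 ^ k < famMax μ S G x}.indicator 1 x ∂μ := by
        apply lintegral_mono
        intro x
        dsimp only
        have h := geom_lower p hp0 (famMax μ S G x / 2)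
        have e : famMax μ S G x ^ p = 2 ^ p * (famMax μ S G x / 2) ^ p := by
          rw [← ENNReal.mul_rpow_of_nonneg _ _ hp0.le, ENNReal.mul_div_cancel (by norm_num) (by norm_num)]
        rw [e, mul_assoc]
        gcongr
        refine h.trans (le_of_eq ?_)
        congr 1
        apply tsum_congr
        intro k
        have : (2 : ℝ≥0∞) ^ k < famMax μ S G x / 2 ↔ 2 * 2 ^ k < famMax μ S G x := by
          rw [ENNReal.lt_div_iff_mul_lt (Or.inl (by norm_num)) (Or.inl (by norm_num)), mul_comm]
        simp only [this, indicator, mem_ofPred_eq, Pi.one_apply, mul_ite, mul_one, mul_zero]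
    _ = 2 ^ p * 2 ^ p * ∑' k : ℤ, (2 ^ k) ^ p * μ {x | 2 * 2 ^ k < famMax μ S G x} := by
        rw [lintegral_const_mul, lintegral_tsum]
        · congr 1
          apply tsum_congr
          intro k
          rw [lintegral_const_mul _ (measurable_one.indicator (hms k)), lintegral_indicator_one (hms k)]
        · exact fun k => ((measurable_one.indicator (hms k)).const_mul _).aemeasurable
        · exact Measurable.tsum fun k => ((measurable_one.indicator (hms k)).const_mul _)
    _ ≤ 2 ^ p * 2 ^ p * ∑' k : ℤ, D * ∫⁻ x, (2 ^ k) ^ (p - 1) * (if 2 ^ k < G x then G x else 0) ∂μ := by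
        refine mul_le_mul' le_rfl (ENNReal.tsum_le_tsum fun k => ?_)
        have e : ((2 : ℝ≥0∞) ^ k) ^ p = (2 ^ k) ^ (p - 1) * 2 ^ k := by
          conv_rhs => rw [← ENNReal.rpow_one ((2 : ℝ≥0∞) ^ k), ← ENNReal.rpow_mul,
            ← ENNReal.rpow_add _ _ (h20 k) (h2t k)]
          congr 1
          ring
        rw [e, mul_assoc, lintegral_const_mul, mul_left_comm D]
        · exact mul_le_mul' le_rfl (hlev k)
        · exact Measurable.ite (measurableSet_lt measurable_const hG) hG measurable_const
    _ = 2 ^ p * 2 ^ p * D * ∫⁻ x, G x * ∑' k : ℤ, (if 2 ^ k < G x then (2 ^ k) ^ (p - 1) else 0) ∂μ := by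
        rw [ENNReal.tsum_mul_left, ← lintegral_tsum, mul_assoc _ D]
        · congr 3
          ext x
          rw [← ENNReal.tsum_mul_left]
          apply tsum_congr
          intro k
          split_ifs <;> ring
        · intro k
          exact ((Measurable.ite (measurableSet_lt measurable_const hG) hG
            measurable_const).const_mul _).aemeasurable
    _ ≤ 2 ^ p * 2 ^ p * D * ∫⁻ x, C * G x ^ p ∂μ := by
        refine mul_le_mul' le_rfl (lintegral_mono fun x => ?_)
        calc _ ≤ G x * (C * G x ^ (p - 1)) := mul_le_mul' le_rfl (hgeo _)
          _ = C * G x ^ p := by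
            have : G x ^ p = G x ^ (1:ℝ) * G x ^ (p-1) := by
              rw [← ENNReal.rpow_add_of_nonneg _ _ (by norm_num) (by linarith)]
              congr 1; ring
            rw [this, ENNReal.rpow_one]; ring
    _ = _ := by
        rw [lintegral_const_mul _ (hG.pow_const p)]; ring

section core
variable {n : ℕ}

lemma vol_ne_zero (c : Fin n → ℝ) {r : ℝ} (hr : 0 < r) : volume (Metric.closedBall c r) ≠ 0 :=
  (Metric.measure_closedBall_pos volume c hr).ne'

lemma vol_ne_top (c : Fin n → ℝ) (r : ℝ) : volume (Metric.closedBall c r) ≠ ∞ :=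
  measure_closedBall_lt_top.ne

lemma vol_five (c : Fin n → ℝ) {r : ℝ} (hr : 0 < r) :
    volume (Metric.closedBall c (5 * r)) = 5 ^ n * volume (Metric.closedBall c r) := by
  rw [Real.volume_pi_closedBall _ (by positivity), Real.volume_pi_closedBall _ hr.le,
    show (2 * (5 * r)) ^ Fintype.card (Fin n) = 5 ^ n * (2 * r) ^ Fintype.card (Fin n) by
      rw [show 2 * (5 * r) = 5 * (2 * r) by ring, mul_pow]; simp,
    ENNReal.ofReal_mul (by positivity), ENNReal.ofReal_pow (by norm_num)]
  norm_num

/-- average of σ over a ball -/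
def sAv (σ : (Fin n → ℝ) → ℝ≥0∞) (c : Fin n → ℝ) (r : ℝ) : ℝ≥0∞ :=
  (volume (Metric.closedBall c r))⁻¹ * ∫⁻ x in Metric.closedBall c r, σ x

def HypK (p : ℝ) (ω σ : (Fin n → ℝ) → ℝ≥0∞) (K : ℝ≥0∞) : Prop :=
  ∀ c r, 0 < r → ∀ t : ℝ≥0∞, t ≠ ∞ → t ≠ 0 →
    (volume (Metric.closedBall c r))⁻¹ * (t * volume {x | x ∈ Metric.closedBall c r ∧ t < ω x}) *
      sAv σ c r ^ (p - 1) ≤ K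

lemma s_ne_zero (σ : (Fin n → ℝ) → ℝ≥0∞) (hσm : Measurable σ) (hσ0 : ∀ x, σ x ≠ 0)
    (c : Fin n → ℝ) {r : ℝ} (hr : 0 < r) : ∫⁻ x in Metric.closedBall c r, σ x ≠ 0 := by
  intro h
  rw [lintegral_eq_zero_iff hσm] at h
  have : ∀ᵐ x ∂(volume.restrict (Metric.closedBall c r)), False := by
    filter_upwards [h] with x hx using hσ0 x hx
  rw [Filter.eventually_false_iff_eq_bot, ae_eq_bot, Measure.restrict_eq_zero] at this
  exact vol_ne_zero c hr this

lemma sAv_ne_zero (σ : (Fin n → ℝ) → ℝ≥0∞) (hσm : Measurable σ) (hσ0 : ∀ x, σ x ≠ 0)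
    (c : Fin n → ℝ) {r : ℝ} (hr : 0 < r) : sAv σ c r ≠ 0 :=
  mul_ne_zero (ENNReal.inv_ne_zero.2 (vol_ne_top c r)) (s_ne_zero σ hσm hσ0 c hr)

lemma sAv_ne_top {p : ℝ} (hp : 1 < p) (ω σ : (Fin n → ℝ) → ℝ≥0∞)
    (hω0 : ∀ x, ω x ≠ 0) {K : ℝ≥0∞} (hK : HypK p ω σ K) (hKt : K ≠ ∞)
    (c : Fin n → ℝ) {r : ℝ} (hr : 0 < r) : sAv σ c r ≠ ∞ := by
  intro h
  have hex : ∃ m : ℕ, volume {x | x ∈ Metric.closedBall c r ∧ ((m : ℝ≥0∞) + 1)⁻¹ < ω x} ≠ 0 := by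
    by_contra hcon
    push Not at hcon
    have h1 := measure_iUnion_null hcon
    apply vol_ne_zero c hr
    refine measure_mono_null ?_ h1
    intro x hx
    rw [mem_iUnion]
    obtain ⟨m, hm⟩ := ENNReal.exists_inv_nat_lt (hω0 x)
    refine ⟨m, hx, lt_of_le_of_lt ?_ hm⟩
    rw [ENNReal.inv_le_inv]
    exact le_self_add
  obtain ⟨m, hm⟩ := hex
  have h2 := hK c r hr ((m : ℝ≥0∞) + 1)⁻¹ (by simp) (by simp)
  rw [h, ENNReal.top_rpow_of_pos (by linarith), ENNReal.mul_top] at h2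
  · exact hKt (top_le_iff.1 h2)
  · refine mul_ne_zero (ENNReal.inv_ne_zero.2 (vol_ne_top c r)) (mul_ne_zero ?_ hm)
    simp

lemma s_eq (σ : (Fin n → ℝ) → ℝ≥0∞) (c : Fin n → ℝ) {r : ℝ} (hr : 0 < r) :
    ∫⁻ x in Metric.closedBall c r, σ x = volume (Metric.closedBall c r) * sAv σ c r := by
  rw [sAv, ← mul_assoc, ENNReal.mul_inv_cancel (vol_ne_zero c hr) (vol_ne_top c r), one_mul]

lemma low_sigma {p : ℝ} (hp : 1 < p) (ω σ : (Fin n → ℝ) → ℝ≥0∞)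
    (hω0 : ∀ x, ω x ≠ 0) (hσ : ∀ x, σ x = ω x ^ (-(1 / (p - 1)))) (hσm : Measurable σ)
    (hσ0 : ∀ x, σ x ≠ 0)
    {K : ℝ≥0∞} (hK : HypK p ω σ K) (hKt : K ≠ ∞) (hK0 : K ≠ 0) (θ : ℝ≥0∞) (hθ0 : θ ≠ 0) (hθt : θ ≠ ∞)
    (c : Fin n → ℝ) {r : ℝ} (hr : 0 < r) :
    volume {x | x ∈ Metric.closedBall c r ∧ σ x < (K / θ) ^ (-(1 / (p - 1))) * sAv σ c r} ≤
      θ * volume (Metric.closedBall c r) := by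
  have hA0 := sAv_ne_zero σ hσm hσ0 c hr
  have hAt := sAv_ne_top hp ω σ hω0 hK hKt c hr
  set A := sAv σ c r with hA
  have hp1 : p - 1 ≠ 0 := by linarith
  have hκ0 : K / θ ≠ 0 := ENNReal.div_ne_zero.2 ⟨hK0, hθt⟩
  have hκt : K / θ ≠ ∞ := ENNReal.div_ne_top hKt hθ0
  have hAp0 : A ^ (1 - p) ≠ 0 := by
    rw [Ne, ENNReal.rpow_eq_zero_iff]; tauto
  have hApt : A ^ (1 - p) ≠ ∞ := by
    rw [Ne, ENNReal.rpow_eq_top_iff]; tauto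
  have hte : (K / θ * A ^ (1 - p)) ^ (-(1 / (p - 1))) = (K / θ) ^ (-(1 / (p - 1))) * A := by
    rw [ENNReal.mul_rpow_of_ne_top hκt hApt, ← ENNReal.rpow_mul]
    congr 1
    rw [show (1 - p) * -(1 / (p - 1)) = 1 by field_simp; ring, ENNReal.rpow_one]
  have hsub : {x | x ∈ Metric.closedBall c r ∧ σ x < (K / θ) ^ (-(1 / (p - 1))) * A} ⊆
      {x | x ∈ Metric.closedBall c r ∧ K / θ * A ^ (1 - p) < ω x} := by
    rintro x ⟨hx, hlt⟩
    refine ⟨hx, ?_⟩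
    by_contra hcon
    push Not at hcon
    rw [← hte, hσ] at hlt
    refine absurd hlt (not_lt.2 ?_)
    rw [ENNReal.rpow_neg, ENNReal.rpow_neg, ENNReal.inv_le_inv]
    exact ENNReal.rpow_le_rpow hcon (one_div_nonneg.2 (by linarith))
  refine (measure_mono hsub).trans ?_
  have h1 := hK c r hr (K / θ * A ^ (1 - p)) (ENNReal.mul_ne_top hκt hApt) (mul_ne_zero hκ0 hAp0)
  rw [← hA] at h1
  set v := volume {x | x ∈ Metric.closedBall c r ∧ K / θ * A ^ (1 - p) < ω x}
  have hAA : A ^ (1 - p) * A ^ (p - 1) = 1 := by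
    rw [← ENNReal.rpow_add _ _ hA0 hAt]; simp
  have h2 : (volume (Metric.closedBall c r))⁻¹ * (K / θ * A ^ (1 - p) * v) * A ^ (p - 1) =
      K * (v / (θ * volume (Metric.closedBall c r))) := by
    calc _ = (volume (Metric.closedBall c r))⁻¹ * (K / θ * v) * (A ^ (1 - p) * A ^ (p - 1)) := by ring
      _ = _ := by
        rw [hAA, div_eq_mul_inv, div_eq_mul_inv, ENNReal.mul_inv (Or.inl hθ0) (Or.inl hθt)]; ring
  rw [h2] at h1
  have h3 : v / (θ * volume (Metric.closedBall c r)) ≤ 1 := by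
    rw [← ENNReal.mul_le_mul_iff_right hK0 hKt, mul_one]
    exact h1
  rwa [ENNReal.div_le_iff (mul_ne_zero hθ0 (vol_ne_zero c hr)) (ENNReal.mul_ne_top hθt (vol_ne_top c r)),
    one_mul] at h3

end core

section core2
variable {n : ℕ}

lemma half_cancel {V X : ℝ≥0∞} (hV : V ≠ ∞) (h : V ≤ X + (V / 4 + V / 4)) : V / 2 ≤ X := by
  have e : V / 4 + V / 4 = V / 2 := by
    rw [← two_mul, show (4 : ℝ≥0∞) = 2 * 2 by norm_num, div_eq_mul_inv, div_eq_mul_inv,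
      ENNReal.mul_inv (by simp) (by simp), mul_left_comm V, ← mul_assoc,
      ENNReal.mul_inv_cancel (by norm_num) (by norm_num), one_mul]
  rw [e] at h
  nth_rewrite 1 [← ENNReal.add_halves V] at h
  exact (ENNReal.add_le_add_iff_right (ENNReal.div_ne_top hV (by norm_num))).1 h

lemma sigma_facts {p : ℝ} (hp : 1 < p) (ω σ : (Fin n → ℝ) → ℝ≥0∞)
    (hω0 : ∀ x, ω x ≠ 0)
    (hσ : ∀ x, σ x = ω x ^ (-(1 / (p - 1)))) (hσm : Measurable σ)
    (hσ0 : ∀ x, σ x ≠ 0)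
    {K : ℝ≥0∞} (hK : HypK p ω σ K) (hKt : K ≠ ∞) (hK0 : K ≠ 0) :
    ∃ c0 D C1 : ℝ≥0∞, c0 ≠ 0 ∧ c0 ≠ ∞ ∧ D ≠ ∞ ∧ C1 ≠ ∞ ∧
      (∀ c r, 0 < r → ∫⁻ x in Metric.closedBall c (5 * r), σ x ≤
        D * ∫⁻ x in Metric.closedBall c r, σ x) ∧
      (∀ c r, 0 < r → ∀ t : ℝ≥0∞, t ≠ ∞ → t ≠ 0 →
        t * volume {x | x ∈ Metric.closedBall c (5 * r) ∧ t < ω x} ≤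
          C1 * ∫⁻ x in Metric.closedBall c r ∩ {x | c0 * sAv σ c r ≤ σ x}, ω x) := by
  have hp1 : p - 1 ≠ 0 := by linarith
  have h5t : (5 : ℝ≥0∞) ^ n ≠ ∞ := by simp
  have h50 : (5 : ℝ≥0∞) ^ n ≠ 0 := by simp
  have h51 : (1 : ℝ≥0∞) ≤ 5 ^ n := one_le_pow₀ (by norm_num)
  set θ : ℝ≥0∞ := (4 * 5 ^ n)⁻¹ with hθ
  have hθ0 : θ ≠ 0 := ENNReal.inv_ne_zero.2 (ENNReal.mul_ne_top (by norm_num) h5t)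
  have hθt : θ ≠ ∞ := ENNReal.inv_ne_top.2 (mul_ne_zero (by norm_num) h50)
  have hκ0 : K / θ ≠ 0 := ENNReal.div_ne_zero.2 ⟨hK0, hθt⟩
  have hκt : K / θ ≠ ∞ := ENNReal.div_ne_top hKt hθ0
  set c0 : ℝ≥0∞ := (K / θ) ^ (-(1 / (p - 1))) with hc0
  have hc00 : c0 ≠ 0 := by
    rw [hc0, Ne, ENNReal.rpow_eq_zero_iff]; tauto
  have hc0t : c0 ≠ ∞ := by
    rw [hc0, Ne, ENNReal.rpow_eq_top_iff]; tauto
  have hlow := fun (c : Fin n → ℝ) (r : ℝ) (hr : 0 < r) =>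
    low_sigma hp ω σ hω0 hσ hσm hσ0 hK hKt hK0 θ hθ0 hθt c hr
  rw [← hc0] at hlow
  have hθ5 : ∀ V : ℝ≥0∞, θ * (5 ^ n * V) = V / 4 := by
    intro V
    rw [hθ, ENNReal.mul_inv (by simp) (by simp), div_eq_mul_inv]
    calc _ = V * 4⁻¹ * ((5 ^ n)⁻¹ * 5 ^ n) := by ring
      _ = _ := by rw [ENNReal.inv_mul_cancel h50 h5t, mul_one]
  have hθV : ∀ V : ℝ≥0∞, θ * V ≤ V / 4 := by
    intro V
    rw [← hθ5]
    gcongr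
    exact le_mul_of_one_le_left (zero_le) h51
  refine ⟨c0, 2 * 5 ^ n / c0, K * 5 ^ n * (5 ^ n) ^ (p - 1) * 4 ^ (p - 1) * 2, hc00, hc0t, ?_, ?_, ?_, ?_⟩
  · exact ENNReal.div_ne_top (ENNReal.mul_ne_top (by norm_num) h5t) hc00
  · have a1 : ((5 : ℝ≥0∞) ^ n) ^ (p - 1) ≠ ∞ := ENNReal.rpow_ne_top_of_nonneg (by linarith) h5t
    have a2 : (4 : ℝ≥0∞) ^ (p - 1) ≠ ∞ := ENNReal.rpow_ne_top_of_nonneg (by linarith) (by norm_num)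
    exact ENNReal.mul_ne_top (ENNReal.mul_ne_top (ENNReal.mul_ne_top
      (ENNReal.mul_ne_top hKt h5t) a1) a2) (by norm_num)
  · intro c r hr
    have hr5 : 0 < 5 * r := by linarith
    have h1 := hlow c (5 * r) hr5
    rw [vol_five c hr, hθ5] at h1
    set V := volume (Metric.closedBall c r) with hV
    have hVt : V ≠ ∞ := vol_ne_top c r
    set A' := sAv σ c (5 * r)
    have hX : V / 2 ≤ volume (Metric.closedBall c r ∩ {x | c0 * A' ≤ σ x}) := by
      apply half_cancel hVt
      calc V ≤ volume ((Metric.closedBall c r ∩ {x | c0 * A' ≤ σ x}) ∪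
              {x | x ∈ Metric.closedBall c (5 * r) ∧ σ x < c0 * A'}) := by
            apply measure_mono
            intro x hx
            by_cases h : c0 * A' ≤ σ x
            · exact Or.inl ⟨hx, h⟩
            · exact Or.inr ⟨Metric.closedBall_subset_closedBall (by linarith) hx, not_le.1 h⟩
        _ ≤ _ := measure_union_le _ _
        _ ≤ _ := by
          gcongr
          exact h1.trans le_self_add
    have h2 : c0 * A' * (V / 2) ≤ ∫⁻ x in Metric.closedBall c r, σ x := by
      calc c0 * A' * (V / 2) ≤ c0 * A' * volume (Metric.closedBall c r ∩ {x | c0 * A' ≤ σ x}) := by gcongr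
        _ = ∫⁻ x in Metric.closedBall c r ∩ {x | c0 * A' ≤ σ x}, c0 * A' := by
          rw [setLIntegral_const]
        _ ≤ ∫⁻ x in Metric.closedBall c r ∩ {x | c0 * A' ≤ σ x}, σ x := by
          apply setLIntegral_mono' (Metric.isClosed_closedBall.measurableSet.inter
            (measurableSet_le measurable_const hσm))
          exact fun x hx => hx.2
        _ ≤ _ := lintegral_mono_set inter_subset_left
    calc ∫⁻ x in Metric.closedBall c (5 * r), σ x = 5 ^ n * V * A' := by
          rw [s_eq σ c hr5, vol_five c hr]
      _ = 2 * 5 ^ n / c0 * (c0 * A' * (V / 2)) := by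
          rw [div_eq_mul_inv, div_eq_mul_inv]
          calc _ = 5 ^ n * V * A' * (c0⁻¹ * c0) * (2 * 2⁻¹) := by
                rw [ENNReal.inv_mul_cancel hc00 hc0t, ENNReal.mul_inv_cancel (by norm_num) (by norm_num)]
                ring
            _ = _ := by ring
      _ ≤ _ := by gcongr
  · intro c r hr t htt ht0
    have hr5 : 0 < 5 * r := by linarith
    have h1 := hlow c r hr
    have hA0 := sAv_ne_zero σ hσm hσ0 c hr
    have hAt := sAv_ne_top hp ω σ hω0 hK hKt c hr
    have hA'0 := sAv_ne_zero σ hσm hσ0 c hr5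
    have hA't := sAv_ne_top hp ω σ hω0 hK hKt c hr5
    have hk := hK c (5 * r) hr5 t htt ht0
    have hAA : sAv σ c r ≤ 5 ^ n * sAv σ c (5 * r) := by
      rw [sAv, sAv, vol_five c hr, ENNReal.mul_inv (Or.inl h50) (Or.inl h5t), ← mul_assoc, ← mul_assoc,
        ENNReal.mul_inv_cancel h50 h5t, one_mul]
      gcongr
      linarith
    have hs := s_eq σ c hr
    have hVt : volume (Metric.closedBall c r) ≠ ∞ := vol_ne_top c r
    have hV0 : volume (Metric.closedBall c r) ≠ 0 := vol_ne_zero c hr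
    rw [vol_five c hr] at hk
    set V := volume (Metric.closedBall c r) with hV
    set A := sAv σ c r
    set A' := sAv σ c (5 * r)
    set v := volume {x | x ∈ Metric.closedBall c (5 * r) ∧ t < ω x}
    have h4A0 : 4 * A ≠ 0 := mul_ne_zero (by norm_num) hA0
    have h4At : 4 * A ≠ ∞ := ENNReal.mul_ne_top (by norm_num) hAt
    have hmark : volume {x | x ∈ Metric.closedBall c r ∧ 4 * A < σ x} ≤ V / 4 := by
      have hm := mul_meas_ge_le_lintegral (μ := volume.restrict (Metric.closedBall c r)) hσm (4 * A)
      rw [hs, Measure.restrict_apply (measurableSet_le measurable_const hσm)] at hm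
      have : volume {x | x ∈ Metric.closedBall c r ∧ 4 * A < σ x} ≤
          volume ({a | 4 * A ≤ σ a} ∩ Metric.closedBall c r) := by
        apply measure_mono
        rintro x ⟨hx, h⟩
        exact ⟨h.le, hx⟩
      refine this.trans ?_
      rw [ENNReal.le_div_iff_mul_le (by simp) (by simp)]
      rw [← ENNReal.mul_le_mul_iff_right hA0 hAt]
      calc _ = 4 * A * volume ({a | 4 * A ≤ σ a} ∩ Metric.closedBall c r) := by ring
        _ ≤ _ := hm
        _ = _ := mul_comm _ _
    set E := Metric.closedBall c r ∩ {x | c0 * A ≤ σ x} with hE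
    set E' := Metric.closedBall c r ∩ {x | c0 * A ≤ σ x} ∩ {x | σ x ≤ 4 * A} with hE'
    have hE'm : MeasurableSet E' := (Metric.isClosed_closedBall.measurableSet.inter
            (measurableSet_le measurable_const hσm)).inter (measurableSet_le hσm measurable_const)
    have hX : V / 2 ≤ volume E' := by
      apply half_cancel hVt
      calc V ≤ volume (E' ∪
              ({x | x ∈ Metric.closedBall c r ∧ σ x < c0 * A} ∪
                {x | x ∈ Metric.closedBall c r ∧ 4 * A < σ x})) := by
            apply measure_mono
            intro x hx
            by_cases h : c0 * A ≤ σ x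
            · by_cases h' : σ x ≤ 4 * A
              · exact Or.inl ⟨⟨hx, h⟩, h'⟩
              · exact Or.inr (Or.inr ⟨hx, not_le.1 h'⟩)
            · exact Or.inr (Or.inl ⟨hx, not_le.1 h⟩)
        _ ≤ _ := measure_union_le _ _
        _ ≤ _ := by
          gcongr
          refine (measure_union_le _ _).trans ?_
          gcongr
          exact h1.trans (hθV V)
    have hW : ((4 * A) ^ (p - 1))⁻¹ * (V / 2) ≤ ∫⁻ x in E, ω x := by
      calc _ ≤ ((4 * A) ^ (p - 1))⁻¹ * volume E' := by gcongr
        _ = ∫⁻ x in E', ((4 * A) ^ (p - 1))⁻¹ := by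
          rw [setLIntegral_const]
        _ ≤ ∫⁻ x in E', ω x := by
          apply setLIntegral_mono' hE'm
          intro x hx
          have : σ x ^ (p - 1) = (ω x)⁻¹ := by
            rw [hσ, ← ENNReal.rpow_mul, show -(1 / (p - 1)) * (p - 1) = -1 by field_simp,
              ENNReal.rpow_neg_one]
          rw [ENNReal.inv_le_iff_inv_le, ← this]
          exact ENNReal.rpow_le_rpow hx.2 (by linarith)
        _ ≤ _ := lintegral_mono_set inter_subset_left
    have hA'p0 : A' ^ (p - 1) ≠ 0 := by
      rw [Ne, ENNReal.rpow_eq_zero_iff]; tauto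
    have hA'pt : A' ^ (p - 1) ≠ ∞ := ENNReal.rpow_ne_top_of_nonneg (by linarith) hA't
    have hAp0 : A ^ (p - 1) ≠ 0 := by
      rw [Ne, ENNReal.rpow_eq_zero_iff]; tauto
    have hApt : A ^ (p - 1) ≠ ∞ := ENNReal.rpow_ne_top_of_nonneg (by linarith) hAt
    have h5V0 : 5 ^ n * V ≠ 0 := mul_ne_zero h50 hV0
    have h5Vt : 5 ^ n * V ≠ ∞ := ENNReal.mul_ne_top h5t hVt
    have h4p0 : (4 : ℝ≥0∞) ^ (p - 1) ≠ 0 := by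
      rw [Ne, ENNReal.rpow_eq_zero_iff]; simp
    have h4pt : (4 : ℝ≥0∞) ^ (p - 1) ≠ ∞ := ENNReal.rpow_ne_top_of_nonneg (by linarith) (by norm_num)
    have hk2 : t * v ≤ K * (5 ^ n * V) * (A' ^ (p - 1))⁻¹ := by
      calc t * v = (5 ^ n * V)⁻¹ * (t * v) * A' ^ (p - 1) * (5 ^ n * V) * (A' ^ (p - 1))⁻¹ := by
            calc _ = t * v * ((5 ^ n * V)⁻¹ * (5 ^ n * V)) * (A' ^ (p - 1) * (A' ^ (p - 1))⁻¹) := by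
                  rw [ENNReal.inv_mul_cancel h5V0 h5Vt, ENNReal.mul_inv_cancel hA'p0 hA'pt]; ring
              _ = _ := by ring
        _ ≤ _ := by gcongr
    have hk3 : (A' ^ (p - 1))⁻¹ ≤ (5 ^ n) ^ (p - 1) * (A ^ (p - 1))⁻¹ := by
      have : A ^ (p - 1) ≤ (5 ^ n) ^ (p - 1) * A' ^ (p - 1) := by
        rw [← ENNReal.mul_rpow_of_nonneg _ _ (by linarith)]
        exact ENNReal.rpow_le_rpow hAA (by linarith)
      rw [← div_eq_mul_inv, ENNReal.le_div_iff_mul_le (Or.inl hAp0) (Or.inl hApt), mul_comm,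
        ← div_eq_mul_inv]
      exact ENNReal.div_le_of_le_mul this
    calc t * v ≤ K * (5 ^ n * V) * ((5 ^ n) ^ (p - 1) * (A ^ (p - 1))⁻¹) := by
          refine hk2.trans ?_
          gcongr
      _ = K * 5 ^ n * (5 ^ n) ^ (p - 1) * 4 ^ (p - 1) * 2 * (((4 * A) ^ (p - 1))⁻¹ * (V / 2)) := by
          rw [ENNReal.mul_rpow_of_nonneg _ _ (by linarith), ENNReal.mul_inv (Or.inl h4p0) (Or.inl h4pt),
            div_eq_mul_inv]
          calc _ = K * (5 ^ n * V) * ((5 ^ n) ^ (p - 1) * (A ^ (p - 1))⁻¹) *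
                (4 ^ (p - 1) * (4 ^ (p - 1))⁻¹) * (2 * 2⁻¹) := by
                  rw [ENNReal.mul_inv_cancel h4p0 h4pt, ENNReal.mul_inv_cancel (by norm_num) (by norm_num)]
                  ring
            _ = _ := by ring
      _ ≤ _ := by gcongr

end core2

section core3
variable {n : ℕ}

lemma core_main {p : ℝ} (hp : 1 < p) (ω σ : (Fin n → ℝ) → ℝ≥0∞) (hωm : Measurable ω)
    (hω0 : ∀ x, ω x ≠ 0) (hωt : ∀ x, ω x ≠ ∞)
    (hσ : ∀ x, σ x = ω x ^ (-(1 / (p - 1))))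
    {K : ℝ≥0∞} (hK : HypK p ω σ K) (hKt : K ≠ ∞) (hK0 : K ≠ 0) :
    ∃ C : ℝ≥0∞, C ≠ ∞ ∧ ∀ (F : (Fin n → ℝ) → ℝ≥0∞) (_ : Measurable F) (t : ℝ≥0∞) (_ : t ≠ 0)
      (_ : t ≠ ∞) (R : ℝ),
      t ^ p * volume {x | ∃ c r, 0 < r ∧ r ≤ R ∧ x ∈ Metric.closedBall c r ∧
        t < ω x ^ (1 / p) * ((volume (Metric.closedBall c r))⁻¹ * ∫⁻ y in Metric.closedBall c r, F y)} ≤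
      C * ∫⁻ x, F x ^ p * ω x := by
  have hp0 : 0 < p := by linarith
  have hp1 : p - 1 ≠ 0 := by linarith
  have hσm : Measurable σ := by
    rw [show σ = fun x => ω x ^ (-(1 / (p - 1))) from funext hσ]
    exact hωm.pow_const _
  have hσ0 : ∀ x, σ x ≠ 0 := by
    intro x
    rw [hσ, Ne, ENNReal.rpow_eq_zero_iff]
    have := hω0 x; have := hωt x; tauto
  have hσt : ∀ x, σ x ≠ ∞ := by
    intro x
    rw [hσ, Ne, ENNReal.rpow_eq_top_iff]
    have := hω0 x; have := hωt x; tauto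
  have hωσ : ∀ x, ω x * σ x ^ p = σ x := by
    intro x
    rw [hσ, ← ENNReal.rpow_mul]
    nth_rewrite 1 [← ENNReal.rpow_one (ω x)]
    rw [← ENNReal.rpow_add _ _ (hω0 x) (hωt x)]
    congr 1
    field_simp
    ring
  have hσω : ∀ x, σ x * (σ x ^ p)⁻¹ = ω x := by
    intro x
    rw [hσ, ← ENNReal.rpow_mul, ← ENNReal.rpow_neg, ← ENNReal.rpow_add _ _ (hω0 x) (hωt x)]
    conv_rhs => rw [← ENNReal.rpow_one (ω x)]
    congr 1
    field_simp
    ring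
  obtain ⟨c0, D, C1, hc00, hc0t, hDt, hC1t, hdoub, hball⟩ :=
    sigma_facts hp ω σ hω0 hσ hσm hσ0 hK hKt hK0
  obtain ⟨Cs, hCst, hstrong⟩ := strong_max n p hp D hDt
  obtain ⟨Cg, hCgt, hgeo⟩ := geom_upper p hp0
  refine ⟨2 ^ p * C1 * Cg * (c0⁻¹) ^ p * Cs, ?_, ?_⟩
  · have a1 : (2 : ℝ≥0∞) ^ p ≠ ∞ := ENNReal.rpow_ne_top_of_nonneg hp0.le (by norm_num)
    have a2 : (c0⁻¹) ^ p ≠ ∞ := ENNReal.rpow_ne_top_of_nonneg hp0.le (by simpa using hc00)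
    exact ENNReal.mul_ne_top (ENNReal.mul_ne_top (ENNReal.mul_ne_top (ENNReal.mul_ne_top a1 hC1t) hCgt) a2) hCst
  intro F hF t ht0 htt R
  have h2t : ∀ k : ℤ, (2 : ℝ≥0∞) ^ k ≠ ∞ := fun k => ENNReal.zpow_ne_top (by norm_num) (by norm_num) k
  have h20 : ∀ k : ℤ, (2 : ℝ≥0∞) ^ k ≠ 0 := fun k => (ENNReal.zpow_pos (by norm_num) (by norm_num) k).ne'
  set T : ℤ → Set ((Fin n → ℝ) × ℝ) := fun k => {b | (0 < b.2 ∧ b.2 ≤ R) ∧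
    2 ^ k < (volume (Metric.closedBall b.1 b.2))⁻¹ * ∫⁻ y in Metric.closedBall b.1 b.2, F y} with hT
  have hvit := fun k => vit_cover (T k) R (fun b hb => hb.1)
  choose u huT huc hud hucov using hvit
  set S : Set ((Fin n → ℝ) × ℝ) := ⋃ k, u k with hS
  have hSc : S.Countable := countable_iUnion huc
  have hSR : ∀ b ∈ S, 0 < b.2 ∧ b.2 ≤ R := by
    intro b hb
    obtain ⟨k, hk⟩ := mem_iUnion.1 hb
    exact (huT k hk).1
  set μ : Measure (Fin n → ℝ) := volume.withDensity σ with hμ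
  have hμb : ∀ c r, μ (Metric.closedBall c r) = ∫⁻ x in Metric.closedBall c r, σ x := fun c r => by
    rw [hμ, withDensity_apply _ Metric.isClosed_closedBall.measurableSet]
  have hst : ∀ c r, 0 < r → ∫⁻ x in Metric.closedBall c r, σ x ≠ ∞ := by
    intro c r hr
    rw [s_eq σ c hr]
    exact ENNReal.mul_ne_top (vol_ne_top c r) (sAv_ne_top hp ω σ hω0 hK hKt c hr)
  set G : (Fin n → ℝ) → ℝ≥0∞ := fun x => F x / σ x with hG
  have hGm : Measurable G := hF.div hσm
  have hσG : ∀ x, σ x * G x = F x := fun x => ENNReal.mul_div_cancel (hσ0 x) (hσt x)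
  have hGb : ∀ c r, ∫⁻ x in Metric.closedBall c r, G x ∂μ = ∫⁻ x in Metric.closedBall c r, F x := by
    intro c r
    rw [hμ, setLIntegral_withDensity_eq_setLIntegral_mul _ hσm hGm Metric.isClosed_closedBall.measurableSet]
    simp only [Pi.mul_apply, hσG]
  set M := famMax μ S G with hM
  have hMm : Measurable M := famMax_meas μ S hSc G
  have hMs : ∫⁻ x, M x ^ p ∂μ ≤ Cs * ∫⁻ x, G x ^ p ∂μ := by
    refine hstrong μ ?_ ?_ ?_ G hGm S hSc R hSR
    · intro c r hr
      rw [hμb, hμb]; exact hdoub c r hr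
    · intro c r hr
      rw [hμb]; exact hst c r hr
    · intro c r hr
      rw [hμb]; exact s_ne_zero σ hσm hσ0 c hr
  have hMs2 : ∫⁻ x, σ x * M x ^ p ≤ Cs * ∫⁻ x, F x ^ p * ω x := by
    rw [hμ, lintegral_withDensity_eq_lintegral_mul _ hσm (hMm.pow_const p),
      lintegral_withDensity_eq_lintegral_mul _ hσm (hGm.pow_const p)] at hMs
    refine hMs.trans (le_of_eq ?_)
    congr 2
    ext x
    simp only [Pi.mul_apply, hG]
    rw [div_eq_mul_inv, ENNReal.mul_rpow_of_nonneg _ _ hp0.le, ENNReal.inv_rpow, mul_left_comm, hσω]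
  set h : (Fin n → ℝ) → ℝ≥0∞ := fun x => σ x * M x with hh
  have hhm : Measurable h := hσm.mul hMm
  set H : ℤ → Set (Fin n → ℝ) := fun k => {x | 2 ^ k < h x / c0} with hH
  have hHm : ∀ k, MeasurableSet (H k) := fun k =>
    measurableSet_lt measurable_const (hhm.div_const _)
  -- good parts of selected balls lie in H k
  have hgood : ∀ k, ∀ b ∈ u k, Metric.closedBall b.1 b.2 ∩ {x | c0 * sAv σ b.1 b.2 ≤ σ x} ⊆
      Metric.closedBall b.1 b.2 ∩ H k := by
    rintro k b hb x ⟨hx, hxs⟩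
    refine ⟨hx, ?_⟩
    have hbT := huT k hb
    have hr : 0 < b.2 := hbT.1.1
    have hlt := hbT.2
    have hMx : (∫⁻ x in Metric.closedBall b.1 b.2, σ x)⁻¹ * ∫⁻ y in Metric.closedBall b.1 b.2, F y ≤ M x := by
      rw [hM, famMax]
      refine le_trans ?_ (le_iSup₂ (f := fun b (_ : b ∈ S) => (Metric.closedBall b.1 b.2).indicator
        (fun _ => (μ (Metric.closedBall b.1 b.2))⁻¹ *
          ∫⁻ y in Metric.closedBall b.1 b.2, G y ∂μ) x) b (mem_iUnion.2 ⟨k, hb⟩))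
      rw [indicator_of_mem hx, hμb, hGb]
    show 2 ^ k < h x / c0
    rw [ENNReal.lt_div_iff_mul_lt (Or.inl hc00) (Or.inl hc0t), mul_comm]
    have hs0 := s_ne_zero σ hσm hσ0 b.1 hr
    have hs1 := hst b.1 b.2 hr
    calc c0 * 2 ^ k < c0 * ((volume (Metric.closedBall b.1 b.2))⁻¹ *
            ∫⁻ y in Metric.closedBall b.1 b.2, F y) :=
          (ENNReal.mul_lt_mul_iff_right hc00 hc0t).2 hlt
      _ = c0 * sAv σ b.1 b.2 * ((∫⁻ x in Metric.closedBall b.1 b.2, σ x)⁻¹ *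
            ∫⁻ y in Metric.closedBall b.1 b.2, F y) := by
          rw [sAv]
          set s := ∫⁻ x in Metric.closedBall b.1 b.2, σ x
          set I := ∫⁻ y in Metric.closedBall b.1 b.2, F y
          set V := (volume (Metric.closedBall b.1 b.2))⁻¹
          calc c0 * (V * I) = c0 * V * I * (s * s⁻¹) := by
                rw [ENNReal.mul_inv_cancel hs0 hs1]; ring
            _ = _ := by ring
      _ ≤ σ x * M x := mul_le_mul' hxs hMx
  set τ : ℤ → ℝ≥0∞ := fun k => t ^ p / (2 ^ (k + 1)) ^ p with hτ
  have htp0 : t ^ p ≠ 0 := by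
    rw [Ne, ENNReal.rpow_eq_zero_iff]; tauto
  have htpt : t ^ p ≠ ∞ := ENNReal.rpow_ne_top_of_nonneg hp0.le htt
  have hkp0 : ∀ k : ℤ, ((2 : ℝ≥0∞) ^ k) ^ p ≠ 0 := by
    intro k
    have := h20 k; have := h2t k
    rw [Ne, ENNReal.rpow_eq_zero_iff]; tauto
  have hkpt : ∀ k : ℤ, ((2 : ℝ≥0∞) ^ k) ^ p ≠ ∞ := fun k => ENNReal.rpow_ne_top_of_nonneg hp0.le (h2t k)
  set X := {x | ∃ c r, 0 < r ∧ r ≤ R ∧ x ∈ Metric.closedBall c r ∧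
        t < ω x ^ (1 / p) * ((volume (Metric.closedBall c r))⁻¹ * ∫⁻ y in Metric.closedBall c r, F y)}
  have hXsub : X ⊆ ⋃ k, ⋃ b ∈ u k, {x | x ∈ Metric.closedBall b.1 (5 * b.2) ∧ τ k < ω x} := by
    rintro x ⟨c, r, hr, hrR, hx, hlt⟩
    have hw0 : ω x ^ (1 / p) ≠ 0 := by
      have := hω0 x; have := hωt x
      rw [Ne, ENNReal.rpow_eq_zero_iff]; tauto
    have hwt : ω x ^ (1 / p) ≠ ∞ := ENNReal.rpow_ne_top_of_nonneg (by positivity) (hωt x)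
    obtain ⟨k, hk1, hk2⟩ := ENNReal.exists_mem_Ico_zpow (x := t / ω x ^ (1 / p))
      (ENNReal.div_ne_zero.2 ⟨ht0, hwt⟩) (ENNReal.div_ne_top htt hw0) (y := 2) (by norm_num) (by norm_num)
    have hbT : (c, r) ∈ T k := by
      refine ⟨⟨hr, hrR⟩, hk1.trans_lt ?_⟩
      rw [ENNReal.div_lt_iff (Or.inl hw0) (Or.inl hwt), mul_comm]
      exact hlt
    have hcov := hucov k _ hbT hx
    simp only [mem_iUnion] at hcov ⊢
    obtain ⟨b, hb, hxb⟩ := hcov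
    refine ⟨k, b, hb, hxb, ?_⟩
    rw [hτ, ENNReal.div_lt_iff (Or.inl (hkp0 _)) (Or.inl (hkpt _))]
    rw [ENNReal.div_lt_iff (Or.inl hw0) (Or.inl hwt)] at hk2
    have := ENNReal.rpow_lt_rpow hk2 hp0
    rw [ENNReal.mul_rpow_of_nonneg _ _ hp0.le, ← ENNReal.rpow_mul, one_div_mul_cancel hp0.ne',
      ENNReal.rpow_one] at this
    rwa [mul_comm]
  have hlev : ∀ k, t ^ p * volume (⋃ b ∈ u k, {x | x ∈ Metric.closedBall b.1 (5 * b.2) ∧ τ k < ω x}) ≤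
      2 ^ p * C1 * ((2 ^ k) ^ p * ∫⁻ x in H k, ω x) := by
    intro k
    have e1 : t ^ p = (2 ^ (k + 1)) ^ p * τ k := by
      rw [hτ]; exact (ENNReal.mul_div_cancel (hkp0 _) (hkpt _)).symm
    have e2 : ((2 : ℝ≥0∞) ^ (k + 1)) ^ p = 2 ^ p * (2 ^ k) ^ p := by
      rw [ENNReal.zpow_add (by norm_num) (by norm_num), ENNReal.mul_rpow_of_nonneg _ _ hp0.le, mul_comm]
      simp
    have := (huc k).to_subtype
    have e3 : τ k * volume (⋃ b ∈ u k, {x | x ∈ Metric.closedBall b.1 (5 * b.2) ∧ τ k < ω x}) ≤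
        C1 * ∫⁻ x in H k, ω x := by
      calc _ ≤ τ k * ∑' b : u k, volume {x | x ∈ Metric.closedBall b.1.1 (5 * b.1.2) ∧ τ k < ω x} :=
            mul_le_mul' le_rfl (measure_biUnion_le _ (huc k) _)
        _ = ∑' b : u k, τ k * volume {x | x ∈ Metric.closedBall b.1.1 (5 * b.1.2) ∧ τ k < ω x} := by
            rw [ENNReal.tsum_mul_left]
        _ ≤ ∑' b : u k, C1 * ∫⁻ x in Metric.closedBall b.1.1 b.1.2, ω x ∂(volume.restrict (H k)) := by
            refine ENNReal.tsum_le_tsum fun b => ?_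
            refine (hball b.1.1 b.1.2 (huT k b.2).1.1 (τ k) ?_ ?_).trans ?_
            · exact ENNReal.div_ne_top htpt (hkp0 _)
            · exact ENNReal.div_ne_zero.2 ⟨htp0, hkpt _⟩
            · rw [Measure.restrict_restrict Metric.isClosed_closedBall.measurableSet]
              exact mul_le_mul' le_rfl (lintegral_mono_set (hgood k b.1 b.2))
        _ = C1 * ∫⁻ x in ⋃ b ∈ u k, Metric.closedBall b.1 b.2, ω x ∂(volume.restrict (H k)) := by
            rw [ENNReal.tsum_mul_left,
              lintegral_biUnion (huc k) (fun _ _ => Metric.isClosed_closedBall.measurableSet) (hud k)]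
        _ ≤ _ := mul_le_mul' le_rfl (setLIntegral_le_lintegral _ _)
    rw [e1, e2, mul_assoc]
    calc _ ≤ 2 ^ p * (2 ^ k) ^ p * (C1 * ∫⁻ x in H k, ω x) := mul_le_mul' le_rfl e3
      _ = _ := by ring
  calc t ^ p * volume X
      ≤ t ^ p * ∑' k, volume (⋃ b ∈ u k, {x | x ∈ Metric.closedBall b.1 (5 * b.2) ∧ τ k < ω x}) :=
        mul_le_mul' le_rfl ((measure_mono hXsub).trans (measure_iUnion_le _))
    _ = ∑' k, t ^ p * volume (⋃ b ∈ u k, {x | x ∈ Metric.closedBall b.1 (5 * b.2) ∧ τ k < ω x}) := by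
        rw [ENNReal.tsum_mul_left]
    _ ≤ ∑' k : ℤ, 2 ^ p * C1 * ((2 ^ k) ^ p * ∫⁻ x in H k, ω x) := ENNReal.tsum_le_tsum hlev
    _ = 2 ^ p * C1 * ∫⁻ x, ∑' k : ℤ, (2 ^ k) ^ p * (H k).indicator ω x := by
        rw [ENNReal.tsum_mul_left, lintegral_tsum]
        · congr 1
          apply tsum_congr
          intro k
          rw [lintegral_const_mul _ (hωm.indicator (hHm k)), lintegral_indicator (hHm k)]
        · exact fun k => ((hωm.indicator (hHm k)).const_mul _).aemeasurable
    _ ≤ 2 ^ p * C1 * ∫⁻ x, Cg * (c0⁻¹) ^ p * (σ x * M x ^ p) := by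
        refine mul_le_mul' le_rfl (lintegral_mono fun x => ?_)
        calc ∑' k : ℤ, (2 ^ k) ^ p * (H k).indicator ω x
            = ω x * ∑' k : ℤ, (if (2 : ℝ≥0∞) ^ k < h x / c0 then ((2 : ℝ≥0∞) ^ k) ^ p else 0) := by
              rw [← ENNReal.tsum_mul_left]
              apply tsum_congr
              intro k
              simp only [indicator, hH, mem_ofPred_eq]
              split_ifs <;> ring
          _ ≤ ω x * (Cg * (h x / c0) ^ p) := mul_le_mul' le_rfl (hgeo _)
          _ = Cg * (c0⁻¹) ^ p * (ω x * σ x ^ p * M x ^ p) := by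
              rw [div_eq_mul_inv, ENNReal.mul_rpow_of_nonneg _ _ hp0.le, hh,
                ENNReal.mul_rpow_of_nonneg _ _ hp0.le]
              ring
          _ = _ := by rw [hωσ]
    _ = 2 ^ p * C1 * Cg * (c0⁻¹) ^ p * ∫⁻ x, σ x * M x ^ p := by
        have hm2 : Measurable fun x => σ x * M x ^ p := hσm.mul (hMm.pow_const p)
        rw [lintegral_const_mul _ hm2]; ring
    _ ≤ 2 ^ p * C1 * Cg * (c0⁻¹) ^ p * (Cs * ∫⁻ x, F x ^ p * ω x) := mul_le_mul' le_rfl hMs2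
    _ = _ := by ring

end core3

lemma isCube_closedBall {n : ℕ} (c : Fin n → ℝ) {r : ℝ} (hr : 0 < r) :
    IsCube n (Metric.closedBall c r) := by
  refine ⟨fun i => c i - r, 2 * r, by linarith, ?_⟩
  rw [closedBall_pi c hr.le]
  congr 1
  ext i : 1
  rw [Real.closedBall_eq_Icc]
  congr 1
  ring

lemma IsCube.exists_ball {n : ℕ} {Q : Set (Fin n → ℝ)} (h : IsCube n Q) :
    ∃ c r, 0 < r ∧ Q = Metric.closedBall c r := by
  obtain ⟨a, l, hl, rfl⟩ := h
  refine ⟨fun i => a i + l / 2, l / 2, by linarith, ?_⟩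
  rw [closedBall_pi _ (by linarith)]
  congr 1
  ext i : 1
  rw [Real.closedBall_eq_Icc]
  congr 1 <;> ring

lemma suff_dir (n : ℕ) (p : ℝ) (hp : 1 < p)
    (w : (Fin n → ℝ) → ℝ) (hwm : Measurable w)
    (hwpos : ∀ᵐ x ∂(volume : Measure (Fin n → ℝ)), 0 < w x) (hA : ApStarConst n p w < ∞) :
    ∃ C : ℝ, 0 < C ∧ ∀ f : (Fin n → ℝ) → ℝ, Measurable f →
        (∫⁻ x, ENNReal.ofReal (|f x| ^ p * w x)) < ∞ →
        wnormE n p (fun x => ENNReal.ofReal (w x ^ (1 / p)) * maximalFn n f x) ≤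
          ENNReal.ofReal C * (∫⁻ x, ENNReal.ofReal (|f x| ^ p * w x)) ^ (1 / p) := by
  have hp0 : 0 < p := by linarith
  have hp1 : p - 1 ≠ 0 := by linarith
  set ω : (Fin n → ℝ) → ℝ≥0∞ := fun x => if 0 < w x then ENNReal.ofReal (w x) else 1 with hω
  have hωm : Measurable ω :=
    Measurable.ite (measurableSet_lt measurable_const hwm) hwm.ennreal_ofReal measurable_const
  have hωe : ∀ x, 0 < w x → ω x = ENNReal.ofReal (w x) := fun x hx => if_pos hx
  have hω0 : ∀ x, ω x ≠ 0 := by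
    intro x
    by_cases h : 0 < w x
    · rw [hωe x h]; simpa using h
    · simp only [hω, if_neg h]; simp
  have hωt : ∀ x, ω x ≠ ∞ := by
    intro x
    by_cases h : 0 < w x
    · rw [hωe x h]; simp
    · simp only [hω, if_neg h]; simp
  set σ : (Fin n → ℝ) → ℝ≥0∞ := fun x => ω x ^ (-(1 / (p - 1))) with hσ
  have hσe : ∀ᵐ x ∂(volume : Measure (Fin n → ℝ)),
      ENNReal.ofReal (w x ^ (1 - p / (p - 1))) = σ x := by
    filter_upwards [hwpos] with x hx
    simp only [hσ]
    rw [hωe x hx, ENNReal.ofReal_rpow_of_pos hx]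
    congr 2
    field_simp
    ring
  have hK : HypK p ω σ (ApStarConst n p w + 1) := by
    intro c r hr t htt ht0
    refine le_trans ?_ le_self_add
    rw [ApStarConst]
    refine le_trans ?_ (le_iSup₂ (f := fun (Q : Set (Fin n → ℝ)) (_ : IsCube n Q) =>
      (volume Q)⁻¹ * wnormE n 1 (Q.indicator fun x => ENNReal.ofReal (w x)) *
      ((volume Q)⁻¹ * ∫⁻ x in Q, ENNReal.ofReal (w x ^ (1 - p / (p - 1)))) ^ (p - 1))
      (Metric.closedBall c r) (isCube_closedBall c hr))
    have e1 : sAv σ c r = (volume (Metric.closedBall c r))⁻¹ *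
        ∫⁻ x in Metric.closedBall c r, ENNReal.ofReal (w x ^ (1 - p / (p - 1))) := by
      rw [sAv]
      congr 1
      exact lintegral_congr_ae (ae_restrict_of_ae (hσe.mono fun x hx => hx.symm))
    rw [e1]
    refine mul_le_mul' (mul_le_mul' le_rfl ?_) le_rfl
    rw [wnormE]
    refine le_trans ?_ (le_iSup₂ (f := fun (t : ℝ) (_ : 0 < t) => ENNReal.ofReal t *
      volume {x | ENNReal.ofReal t < (Metric.closedBall c r).indicator
        (fun x => ENNReal.ofReal (w x)) x} ^ (1 / (1 : ℝ))) t.toReal (ENNReal.toReal_pos ht0 htt))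
    rw [ENNReal.ofReal_toReal htt, div_one, ENNReal.rpow_one]
    refine mul_le_mul' le_rfl (measure_mono_ae ?_)
    filter_upwards [hwpos] with x hx
    rintro ⟨hxB, hlt⟩
    show t < (Metric.closedBall c r).indicator (fun x => ENNReal.ofReal (w x)) x
    rw [indicator_of_mem hxB, ← hωe x hx]
    exact hlt
  obtain ⟨C, hCt, hC⟩ := core_main hp ω σ hωm hω0 hωt (fun x => rfl) hK
    (ENNReal.add_ne_top.2 ⟨hA.ne, ENNReal.one_ne_top⟩) (by simp)
  refine ⟨(C ^ (1 / p)).toReal + 1, by positivity, ?_⟩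
  intro f hf _
  have hCp : C ^ (1 / p) ≠ ∞ := ENNReal.rpow_ne_top_of_nonneg (by positivity) hCt
  set F : (Fin n → ℝ) → ℝ≥0∞ := fun x => ENNReal.ofReal |f x| with hF
  have hFm : Measurable F := (measurable_norm.comp hf).ennreal_ofReal
  have hI : ∫⁻ x, ENNReal.ofReal (|f x| ^ p * w x) = ∫⁻ x, F x ^ p * ω x := by
    apply lintegral_congr_ae
    filter_upwards [hwpos] with x hx
    rw [hωe x hx, hF, ENNReal.ofReal_rpow_of_nonneg (abs_nonneg _) hp0.le,
      ENNReal.ofReal_mul (by positivity)]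
  rw [hI]
  set I := ∫⁻ x, F x ^ p * ω x
  rw [wnormE]
  refine iSup₂_le fun t ht => ?_
  set X : ℕ → Set (Fin n → ℝ) := fun m => {x | ∃ c r, 0 < r ∧ r ≤ (m : ℝ) ∧ x ∈ Metric.closedBall c r ∧
        ENNReal.ofReal t < ω x ^ (1 / p) * ((volume (Metric.closedBall c r))⁻¹ *
          ∫⁻ y in Metric.closedBall c r, F y)} with hX
  have hXmono : Monotone X := by
    intro a b hab x hx
    obtain ⟨c, r, hr, hra, h⟩ := hx
    exact ⟨c, r, hr, hra.trans (by exact_mod_cast hab), h⟩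
  have hsub : volume {x | ENNReal.ofReal t < ENNReal.ofReal (w x ^ (1 / p)) * maximalFn n f x} ≤
      volume (⋃ m, X m) := by
    apply measure_mono_ae
    filter_upwards [hwpos] with x hx
    intro (hlt : ENNReal.ofReal t < ENNReal.ofReal (w x ^ (1 / p)) * maximalFn n f x)
    rw [maximalFn] at hlt
    simp only [ENNReal.mul_iSup, lt_iSup_iff] at hlt
    obtain ⟨Q, hQ, hxQ, hlt⟩ := hlt
    obtain ⟨c, r, hr, rfl⟩ := hQ.exists_ball
    obtain ⟨m, hm⟩ := exists_nat_ge r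
    refine mem_iUnion.2 ⟨m, c, r, hr, hm, hxQ, ?_⟩
    rw [hωe x hx, ENNReal.ofReal_rpow_of_pos hx]
    exact hlt
  have hmain : ENNReal.ofReal t ^ p *
      volume {x | ENNReal.ofReal t < ENNReal.ofReal (w x ^ (1 / p)) * maximalFn n f x} ≤ C * I := by
    refine (mul_le_mul' le_rfl hsub).trans ?_
    rw [hXmono.measure_iUnion, ENNReal.mul_iSup]
    exact iSup_le fun m => hC F hFm (ENNReal.ofReal t) (by simpa using ht) (by simp) m
  have h2 := ENNReal.rpow_le_rpow hmain (z := 1 / p) (by positivity)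
  rw [ENNReal.mul_rpow_of_nonneg _ _ (by positivity), ENNReal.mul_rpow_of_nonneg _ _ (by positivity),
    ← ENNReal.rpow_mul, mul_one_div_cancel hp0.ne', ENNReal.rpow_one] at h2
  refine h2.trans (mul_le_mul' ?_ le_rfl)
  rw [ENNReal.ofReal_add (by positivity) (by norm_num), ENNReal.ofReal_toReal hCp]
  exact le_self_add

lemma nec_dir (n : ℕ) (p : ℝ) (hp : 1 < p)
    (w : (Fin n → ℝ) → ℝ) (hwm : Measurable w) (hw0 : ∀ x, 0 ≤ w x)
    (hwpos : ∀ᵐ x ∂(volume : Measure (Fin n → ℝ)), 0 < w x) (C : ℝ)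
    (hC : ∀ f : (Fin n → ℝ) → ℝ, Measurable f →
        (∫⁻ x, ENNReal.ofReal (|f x| ^ p * w x)) < ∞ →
        wnormE n p (fun x => ENNReal.ofReal (w x ^ (1 / p)) * maximalFn n f x) ≤
          ENNReal.ofReal C * (∫⁻ x, ENNReal.ofReal (|f x| ^ p * w x)) ^ (1 / p)) :
    ApStarConst n p w ≤ ENNReal.ofReal C ^ p := by
  have hp0 : 0 < p := by linarith
  have hp1 : p - 1 ≠ 0 := by linarith
  have hp1' : 0 < p - 1 := by linarith
  rw [ApStarConst]
  refine iSup₂_le fun Q hQ => ?_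
  obtain ⟨c, r, hr, rfl⟩ := hQ.exists_ball
  rw [wnormE]
  simp only [ENNReal.mul_iSup, ENNReal.iSup_mul]
  refine iSup₂_le fun t ht => ?_
  have hV0 := vol_ne_zero c hr
  have hVt := vol_ne_top c r
  have hQm : MeasurableSet (Metric.closedBall c r) := Metric.isClosed_closedBall.measurableSet
  set Q := Metric.closedBall c r with hQdef
  set V := volume Q
  rw [div_one, ENNReal.rpow_one]
  set v := volume {x | ENNReal.ofReal t < Q.indicator (fun x => ENNReal.ofReal (w x)) x} with hv
  have hvt : v ≠ ∞ := by
    refine ne_top_of_le_ne_top hVt (measure_mono ?_)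
    intro x hx
    by_contra hxQ
    have hx' : ENNReal.ofReal t < Q.indicator (fun x => ENNReal.ofReal (w x)) x := hx
    rw [indicator_of_notMem hxQ] at hx'
    simp at hx'
  set e : ℝ := 1 - p / (p - 1) with he
  have hee : e = -(1 / (p - 1)) := by rw [he]; field_simp; ring
  have he0 : e ≤ 0 := by rw [hee]; simp [hp1'.le]
  set s : ℕ → (Fin n → ℝ) → ℝ := fun k x => (w x + 1 / ((k : ℝ) + 1)) ^ e with hs
  have hkpos : ∀ k : ℕ, (0 : ℝ) < 1 / ((k : ℝ) + 1) := fun k => by positivity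
  have hwk : ∀ (k : ℕ) (x : Fin n → ℝ), 0 < w x + 1 / ((k : ℝ) + 1) := fun k x => add_pos_of_nonneg_of_pos (hw0 x) (hkpos k)
  have hspos : ∀ k x, 0 < s k x := fun k x => Real.rpow_pos_of_pos (hwk k x) _
  have hsm : ∀ k, Measurable (s k) := fun k => (hwm.add_const _).pow_const _
  set a : ℕ → ℝ≥0∞ := fun k => V⁻¹ * ∫⁻ x in Q, ENNReal.ofReal (s k x) with ha
  have hVa : ∀ k, ∫⁻ x in Q, ENNReal.ofReal (s k x) = V * a k := by
    intro k
    rw [ha, ← mul_assoc, ENNReal.mul_inv_cancel hV0 hVt, one_mul]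
  have hat : ∀ k, a k ≠ ∞ := by
    intro k
    refine ENNReal.mul_ne_top (ENNReal.inv_ne_top.2 hV0) (ne_top_of_le_ne_top ?_
      (lintegral_mono (g := fun _ => ENNReal.ofReal ((1 / ((k : ℝ) + 1)) ^ e)) fun x => ?_))
    · rw [setLIntegral_const]
      exact ENNReal.mul_ne_top (by simp) hVt
    · apply ENNReal.ofReal_le_ofReal
      exact Real.rpow_le_rpow_of_nonpos (hkpos k) (by linarith [hw0 x]) he0
  have ha0 : ∀ k, a k ≠ 0 := by
    intro k
    refine mul_ne_zero (ENNReal.inv_ne_zero.2 hVt) ?_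
    exact s_ne_zero (fun x => ENNReal.ofReal (s k x)) (hsm k).ennreal_ofReal
      (fun x => by simpa using hspos k x) c hr
  -- the bound for truncations
  have hk : ∀ k, V⁻¹ * (ENNReal.ofReal t * v) * a k ^ (p - 1) ≤ ENNReal.ofReal C ^ p := by
    intro k
    set f : (Fin n → ℝ) → ℝ := Q.indicator (s k) with hf
    have hfm : Measurable f := (hsm k).indicator hQm
    have hnorm : ∫⁻ x, ENNReal.ofReal (|f x| ^ p * w x) ≤ V * a k := by
      rw [← hVa, ← lintegral_indicator hQm]
      apply lintegral_mono
      intro x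
      dsimp only
      by_cases hx : x ∈ Q
      · rw [hf, indicator_of_mem hx, indicator_of_mem hx, abs_of_pos (hspos k x)]
        apply ENNReal.ofReal_le_ofReal
        calc s k x ^ p * w x ≤ s k x ^ p * (w x + 1 / ((k : ℝ) + 1)) := by
              gcongr
              · exact (Real.rpow_pos_of_pos (hspos k x) _).le
              · linarith [hkpos k]
          _ = s k x := by
              rw [hs]
              dsimp only
              rw [← Real.rpow_mul (hwk k x).le]
              nth_rewrite 2 [← Real.rpow_one (w x + 1 / ((k : ℝ) + 1))]
              rw [← Real.rpow_add (hwk k x)]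
              congr 1
              rw [hee]; field_simp; ring
      · rw [hf, indicator_of_notMem hx, indicator_of_notMem hx, abs_zero, Real.zero_rpow hp0.ne']
        simp
    have h1 := hC f hfm (hnorm.trans_lt (ENNReal.mul_lt_top hVt.lt_top (hat k).lt_top))
    have hsr : 0 < t ^ (1 / p) * (a k).toReal :=
      mul_pos (Real.rpow_pos_of_pos ht _) (ENNReal.toReal_pos (ha0 k) (hat k))
    have h2 := (le_iSup₂ (f := fun (t : ℝ) (_ : 0 < t) => ENNReal.ofReal t *
      volume {x | ENNReal.ofReal t < ENNReal.ofReal (w x ^ (1 / p)) * maximalFn n f x} ^ (1 / p))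
      (t ^ (1 / p) * (a k).toReal) hsr).trans h1
    have e1 : ENNReal.ofReal (t ^ (1 / p) * (a k).toReal) = ENNReal.ofReal t ^ (1 / p) * a k := by
      rw [ENNReal.ofReal_mul (by positivity), ENNReal.ofReal_toReal (hat k),
        ENNReal.ofReal_rpow_of_pos ht]
    rw [e1] at h2
    have hvle : v ≤ volume {x | ENNReal.ofReal t ^ (1 / p) * a k <
        ENNReal.ofReal (w x ^ (1 / p)) * maximalFn n f x} := by
      apply measure_mono
      intro x hx
      have hx' : ENNReal.ofReal t < Q.indicator (fun x => ENNReal.ofReal (w x)) x := hx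
      have hxQ : x ∈ Q := by
        by_contra hxQ
        rw [indicator_of_notMem hxQ] at hx'
        simp at hx'
      rw [indicator_of_mem hxQ] at hx'
      show ENNReal.ofReal t ^ (1 / p) * a k < ENNReal.ofReal (w x ^ (1 / p)) * maximalFn n f x
      have hM : a k ≤ maximalFn n f x := by
        rw [maximalFn]
        refine le_trans ?_ (le_iSup₂_of_le Q hQ (le_iSup_of_le hxQ le_rfl))
        refine mul_le_mul' le_rfl (le_of_eq ?_)
        apply setLIntegral_congr_fun hQm
        intro y hy
        dsimp only
        rw [hf, indicator_of_mem hy, abs_of_pos (hspos k y)]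
      refine lt_of_lt_of_le ?_ (mul_le_mul' le_rfl hM)
      rw [ENNReal.mul_lt_mul_iff_left (ha0 k) (hat k), ← ENNReal.ofReal_rpow_of_nonneg (hw0 x) (by positivity)]
      exact ENNReal.rpow_lt_rpow hx' (by positivity)
    have h3 : ENNReal.ofReal t ^ (1 / p) * a k * v ^ (1 / p) ≤
        ENNReal.ofReal C * (V * a k) ^ (1 / p) := by
      calc _ ≤ _ := mul_le_mul' le_rfl (ENNReal.rpow_le_rpow hvle (by positivity))
        _ ≤ _ := h2
        _ ≤ _ := mul_le_mul' le_rfl (ENNReal.rpow_le_rpow hnorm (by positivity))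
    have h4 := ENNReal.rpow_le_rpow h3 hp0.le
    rw [ENNReal.mul_rpow_of_nonneg (ENNReal.ofReal t ^ (1 / p) * a k) _ hp0.le,
      ENNReal.mul_rpow_of_nonneg (ENNReal.ofReal t ^ (1 / p)) (a k) hp0.le,
      ENNReal.mul_rpow_of_nonneg (ENNReal.ofReal C) _ hp0.le, ← ENNReal.rpow_mul, ← ENNReal.rpow_mul,
      ← ENNReal.rpow_mul, one_div_mul_cancel hp0.ne', ENNReal.rpow_one, ENNReal.rpow_one,
      ENNReal.rpow_one] at h4
    have e2 : a k ^ p = a k ^ (p - 1) * a k := by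
      conv_rhs => rw [← ENNReal.rpow_one (a k), ← ENNReal.rpow_mul,
        ← ENNReal.rpow_add _ _ (ha0 k) (hat k)]
      congr 1; ring
    have hVa0 : V * a k ≠ 0 := mul_ne_zero hV0 (ha0 k)
    have hVat : V * a k ≠ ∞ := ENNReal.mul_ne_top hVt (hat k)
    rw [← ENNReal.mul_le_mul_iff_left hVa0 hVat]
    refine le_trans (le_of_eq ?_) h4
    rw [e2]
    calc _ = (V⁻¹ * V) * (ENNReal.ofReal t * (a k ^ (p - 1) * a k) * v) := by ring
      _ = _ := by rw [ENNReal.inv_mul_cancel hV0 hVt, one_mul]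
  -- pass to the limit
  have hlim : Filter.Tendsto (fun k => ∫⁻ x in Q, ENNReal.ofReal (s k x)) Filter.atTop
      (nhds (∫⁻ x in Q, ENNReal.ofReal (w x ^ e))) := by
    apply lintegral_tendsto_of_tendsto_of_monotone
    · exact fun k => (hsm k).ennreal_ofReal.aemeasurable
    · refine Filter.Eventually.of_forall fun x => ?_
      intro i j hij
      apply ENNReal.ofReal_le_ofReal
      refine Real.rpow_le_rpow_of_nonpos (hwk j x) ?_ he0
      have : (1 : ℝ) / ((j : ℝ) + 1) ≤ 1 / ((i : ℝ) + 1) := by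
        apply one_div_le_one_div_of_le (by positivity)
        have : (i : ℝ) ≤ j := by exact_mod_cast hij
        linarith
      linarith
    · filter_upwards [ae_restrict_of_ae hwpos] with x hx
      apply ENNReal.tendsto_ofReal
      have h1 : Filter.Tendsto (fun k : ℕ => w x + 1 / ((k : ℝ) + 1)) Filter.atTop (nhds (w x)) := by
        simpa using (tendsto_one_div_add_atTop_nhds_zero_nat (𝕜 := ℝ)).const_add (w x)
      exact h1.rpow_const (Or.inl hx.ne')
  have hlim2 : Filter.Tendsto (fun k => V⁻¹ * (ENNReal.ofReal t * v) * a k ^ (p - 1)) Filter.atTop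
      (nhds (V⁻¹ * (ENNReal.ofReal t * v) *
        (V⁻¹ * ∫⁻ x in Q, ENNReal.ofReal (w x ^ e)) ^ (p - 1))) := by
    apply ENNReal.Tendsto.const_mul
    · exact (ENNReal.continuous_rpow_const.tendsto _).comp
        (ENNReal.Tendsto.const_mul hlim (Or.inr (ENNReal.inv_ne_top.2 hV0)))
    · exact Or.inr (ENNReal.mul_ne_top (ENNReal.inv_ne_top.2 hV0)
        (ENNReal.mul_ne_top (by simp) hvt))
  exact le_of_tendsto' hlim2 hk

/-- For `n ≥ 1`, `1 < p < ∞` and a weight `w` on `ℝⁿ`, the multiplier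
weak-type inequality `‖w^{1/p}·Mf‖_{L^{p,∞}} ≤ C·‖f‖_{L^p(w)}` holds for all `f ∈ L^p(w)`
for some `C > 0` if and only if `w ∈ A_p^*`. -/
theorem statement0 (n : ℕ) (hn : 1 ≤ n) (p : ℝ) (hp : 1 < p)
    (w : (Fin n → ℝ) → ℝ) (hwm : Measurable w) (hw0 : ∀ x, 0 ≤ w x)
    (hwpos : ∀ᵐ x ∂(volume : Measure (Fin n → ℝ)), 0 < w x) :
    (∃ C : ℝ, 0 < C ∧ ∀ f : (Fin n → ℝ) → ℝ, Measurable f →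
        (∫⁻ x, ENNReal.ofReal (|f x| ^ p * w x)) < ∞ →
        wnormE n p (fun x => ENNReal.ofReal (w x ^ (1 / p)) * maximalFn n f x) ≤
          ENNReal.ofReal C * (∫⁻ x, ENNReal.ofReal (|f x| ^ p * w x)) ^ (1 / p)) ↔
      ApStarConst n p w < ∞ := by
  constructor
  · rintro ⟨C, -, hC⟩
    exact (nec_dir n p hp w hwm hw0 hwpos C hC).trans_lt
      (ENNReal.rpow_lt_top_of_nonneg (by linarith) ENNReal.ofReal_ne_top)
  · exact suff_dir n p hp w hwm hwpos
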